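/- Fix 0 < R₁ < R₂ and an integer N ≥ 1. For every k ≥ 1, the function ε ↦ λ_k(𝔇(N,ε)) is nonincreasing and continuous on [0, π/N]; moreover λ_k(𝔇(N,0)) = λ_k(D_{R₁,R₂}) and λ_k(𝔇(N,π/N)) = λ_k(B_{R₂}). -/

import Mathlib

open MeasureTheory Real Set

noncomputable section

/-- A Dirichlet test function on `ω`: smooth, compactly supported, with support in `ω`. -/
def testFun (ω : Set (ℝ × ℝ)) (u : (ℝ × ℝ) → ℝ) : Prop :=
  ContDiff ℝ (⊤ : ℕ∞) u ∧ HasCompactSupport u ∧ tsupport u ⊆ ω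

/-- `|∇u|²` at a point. -/
def gradSq (u : (ℝ × ℝ) → ℝ) (x : ℝ × ℝ) : ℝ :=
  fderiv ℝ u x (1, 0) ^ 2 + fderiv ℝ u x (0, 1) ^ 2

/-- The Rayleigh quotient of `u` on `ω`. -/
def rayleigh (ω : Set (ℝ × ℝ)) (u : (ℝ × ℝ) → ℝ) : ℝ :=
  (∫ x in ω, gradSq u x) / ∫ x in ω, u x ^ 2

/-- The `k`-th Dirichlet eigenvalue of `ω` (`k ≥ 1`), via the Courant–Fischer
min-max formula over `k`-dimensional subspaces of `C_c^∞(ω)`. -/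
def dirichletEV (ω : Set (ℝ × ℝ)) (k : ℕ) : ℝ :=
  sInf {l | ∃ V : Submodule ℝ ((ℝ × ℝ) → ℝ),
    (V : Set ((ℝ × ℝ) → ℝ)) ⊆ {u | testFun ω u} ∧ Module.finrank ℝ V = k ∧
    l = sSup {r | ∃ u ∈ V, u ≠ 0 ∧ r = rayleigh ω u}}

/-- The open disk `B_R` centered at the origin. -/
def disk (R : ℝ) : Set (ℝ × ℝ) := {x | x.1 ^ 2 + x.2 ^ 2 < R ^ 2}

/-- The open annulus `M_{R₁,R₂} = B_{R₂} \ closure (B_{R₁})`. -/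
def annulus (R₁ R₂ : ℝ) : Set (ℝ × ℝ) := disk R₂ \ closure (disk R₁)

/-- `D_{R₁,R₂} = B_{R₁} ∪ M_{R₁,R₂}`. -/
def diskUnionAnnulus (R₁ R₂ : ℝ) : Set (ℝ × ℝ) := disk R₁ ∪ annulus R₁ R₂

/-- The cracked domain `𝔇(N,ε)`. -/
def crackedDomain (R₁ R₂ : ℝ) (N : ℕ) (ε : ℝ) : Set (ℝ × ℝ) :=
  diskUnionAnnulus R₁ R₂ ∪
    ⋃ j ∈ Finset.range N, {x | ∃ θ : ℝ, θ ∈ Set.Ioo (2 * π * j / N - ε) (2 * π * j / N + ε) ∧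
      x = (R₁ * Real.cos θ, R₁ * Real.sin θ)}

theorem LinearMap.exists_norm_le_of_injective {V E F : Type*} [AddCommGroup V] [Module ℝ V]
    [FiniteDimensional ℝ V] [NormedAddCommGroup E] [NormedSpace ℝ E] [NormedAddCommGroup F]
    [NormedSpace ℝ F] (T : V →ₗ[ℝ] E) (S : V →ₗ[ℝ] F) (hT : Function.Injective T) :
    ∃ C : ℝ, ∀ v, ‖S v‖ ≤ C * ‖T v‖ := by
  let e := LinearEquiv.ofInjective T hT
  let A : LinearMap.range T →L[ℝ] F := LinearMap.toContinuousLinearMap (S ∘ₗ e.symm.toLinearMap)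
  refine ⟨‖A‖, fun v => ?_⟩
  have h := A.le_opNorm (e v)
  have h1 : A (e v) = S v := by simp [A]
  rw [h1] at h
  exact h

theorem continuous_fderiv_apply_of_contDiff {u : ℝ × ℝ → ℝ} (hu : ContDiff ℝ (⊤ : ℕ∞) u)
    (v : ℝ × ℝ) : Continuous fun x => fderiv ℝ u x v :=
  (hu.continuous_fderiv (by simp)).clm_apply continuous_const

namespace testFun

variable {ω ω' : Set (ℝ × ℝ)} {u : ℝ × ℝ → ℝ}

theorem mono (hu : testFun ω u) (h : ω ⊆ ω') : testFun ω' u :=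
  ⟨hu.1, hu.2.1, hu.2.2.trans h⟩

theorem differentiable (hu : testFun ω u) : Differentiable ℝ u :=
  hu.1.differentiable (by simp)

theorem continuous_gradSq (hu : testFun ω u) : Continuous (gradSq u) :=
  ((continuous_fderiv_apply_of_contDiff hu.1 _).pow 2).add
    ((continuous_fderiv_apply_of_contDiff hu.1 _).pow 2)

theorem gradSq_eq_zero (x : ℝ × ℝ) (hx : x ∉ tsupport u) : gradSq u x = 0 := by
  have h : fderiv ℝ u x = 0 := by
    by_contra h
    exact hx (tsupport_fderiv_subset ℝ (subset_tsupport _ h))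
  simp [gradSq, h]

theorem integrable_of_continuous (hu : testFun ω u) {f : ℝ × ℝ → ℝ} (hf : Continuous f)
    (h : ∀ x, x ∉ tsupport u → f x = 0) : Integrable f :=
  hf.integrable_of_hasCompactSupport (HasCompactSupport.intro hu.2.1 h)

theorem integrable_gradSq (hu : testFun ω u) : Integrable (gradSq u) :=
  hu.integrable_of_continuous hu.continuous_gradSq gradSq_eq_zero

theorem integrable_sq (hu : testFun ω u) : Integrable fun x => u x ^ 2 :=
  hu.integrable_of_continuous (hu.1.continuous.pow 2) fun x hx => by
    simp [image_eq_zero_of_notMem_tsupport hx]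

theorem integral_sq_pos (hu : testFun ω u) (h0 : u ≠ 0) : 0 < ∫ x, u x ^ 2 := by
  obtain ⟨x, hx⟩ := Function.ne_iff.1 h0
  refine (hu.1.continuous.pow 2).integral_pos_of_hasCompactSupport_nonneg_nonzero
    (HasCompactSupport.intro hu.2.1 fun x hx => ?_) (fun x => sq_nonneg _) (x := x)
    (pow_ne_zero 2 hx)
  simp [image_eq_zero_of_notMem_tsupport hx]

theorem rayleigh_eq (hu : testFun ω u) :
    rayleigh ω u = (∫ x, gradSq u x) / ∫ x, u x ^ 2 := by
  unfold rayleigh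
  rw [setIntegral_eq_integral_of_forall_compl_eq_zero,
    setIntegral_eq_integral_of_forall_compl_eq_zero]
  · intro x hx
    simp [image_eq_zero_of_notMem_tsupport fun h => hx (hu.2.2 h)]
  · intro x hx
    exact gradSq_eq_zero x fun h => hx (hu.2.2 h)

theorem memLp (hu : testFun ω u) : MemLp u 2 :=
  hu.1.continuous.memLp_of_hasCompactSupport hu.2.1

theorem memLp_fderiv (hu : testFun ω u) (v : ℝ × ℝ) : MemLp (fun x => fderiv ℝ u x v) 2 :=
  (continuous_fderiv_apply_of_contDiff hu.1 v).memLp_of_hasCompactSupport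
    (hu.2.1.fderiv_apply ℝ v)

end testFun

theorem gradSq_nonneg (u : ℝ × ℝ → ℝ) (x : ℝ × ℝ) : 0 ≤ gradSq u x := by
  unfold gradSq; positivity

theorem MeasureTheory.MemLp.norm_toLp_sq {f : ℝ × ℝ → ℝ} (hf : MemLp f 2) :
    ‖hf.toLp f‖ ^ 2 = ∫ x, f x ^ 2 := by
  rw [← real_inner_self_eq_norm_sq, L2.inner_def]
  refine integral_congr_ae ?_
  filter_upwards [hf.coeFn_toLp] with x hx
  simp [hx, pow_two]

/-- On a finite-dimensional space of test functions the Dirichlet energy is controlled by the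
`L²` norm. -/
theorem exists_integral_gradSq_le {ω : Set (ℝ × ℝ)} (V : Submodule ℝ (ℝ × ℝ → ℝ))
    [FiniteDimensional ℝ V] (hV : ∀ u ∈ V, testFun ω u) :
    ∃ C : ℝ, ∀ u ∈ V, ∫ x, gradSq u x ≤ C * ∫ x, u x ^ 2 := by
  let T : V →ₗ[ℝ] Lp ℝ 2 (volume : Measure (ℝ × ℝ)) :=
    { toFun := fun u => (hV u u.2).memLp.toLp
      map_add' := fun u v => MemLp.toLp_add (hV u u.2).memLp (hV v v.2).memLp
      map_smul' := fun c u => MemLp.toLp_const_smul c (hV u u.2).memLp }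
  let S (w : ℝ × ℝ) : V →ₗ[ℝ] Lp ℝ 2 (volume : Measure (ℝ × ℝ)) :=
    { toFun := fun u => ((hV u u.2).memLp_fderiv w).toLp
      map_add' := fun u v => by
        rw [← MemLp.toLp_add]
        congr 1
        ext x
        simp [fderiv_add ((hV u u.2).differentiable x) ((hV v v.2).differentiable x)]
      map_smul' := fun c u => by
        rw [RingHom.id_apply, ← MemLp.toLp_const_smul]
        congr 1
        ext x
        simp [fderiv_const_smul ((hV u u.2).differentiable x) c] }
  have hTn (u : V) : ‖T u‖ ^ 2 = ∫ x, u.1 x ^ 2 := (hV u u.2).memLp.norm_toLp_sq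
  have hSn (w : ℝ × ℝ) (u : V) : ‖S w u‖ ^ 2 = ∫ x, fderiv ℝ u.1 x w ^ 2 :=
    ((hV u u.2).memLp_fderiv w).norm_toLp_sq
  have hT : Function.Injective T := by
    rw [injective_iff_map_eq_zero]
    intro u hu
    by_contra h0
    have h := (hV u u.2).integral_sq_pos fun h => h0 (Subtype.ext h)
    rw [← hTn, hu] at h
    simp at h
  obtain ⟨C₁, h₁⟩ := T.exists_norm_le_of_injective (S (1, 0)) hT
  obtain ⟨C₂, h₂⟩ := T.exists_norm_le_of_injective (S (0, 1)) hT
  refine ⟨C₁ ^ 2 + C₂ ^ 2, fun u hu => ?_⟩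
  have e : ∫ x, gradSq u x = ‖S (1, 0) ⟨u, hu⟩‖ ^ 2 + ‖S (0, 1) ⟨u, hu⟩‖ ^ 2 := by
    rw [hSn, hSn, ← integral_add]
    · rfl
    · exact ((hV u hu).memLp_fderiv _).integrable_sq
    · exact ((hV u hu).memLp_fderiv _).integrable_sq
  have e' := hTn ⟨u, hu⟩
  simp only at e'
  rw [e, ← e', add_mul, ← mul_pow, ← mul_pow]
  gcongr
  · exact h₁ _
  · exact h₂ _

/-- There is a `k`-dimensional space of test functions on `ω` with Rayleigh quotients at most
`l`. -/
def HasTrialSpace (ω : Set (ℝ × ℝ)) (k : ℕ) (l : ℝ) : Prop :=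
  ∃ V : Submodule ℝ (ℝ × ℝ → ℝ), (∀ u ∈ V, testFun ω u) ∧ Module.finrank ℝ V = k ∧
    ∀ u ∈ V, ∫ x, gradSq u x ≤ l * ∫ x, u x ^ 2

theorem HasTrialSpace.mono {ω ω' : Set (ℝ × ℝ)} {k : ℕ} {l : ℝ} (h : HasTrialSpace ω k l)
    (hω : ω ⊆ ω') : HasTrialSpace ω' k l := by
  obtain ⟨V, h1, h2, h3⟩ := h
  exact ⟨V, fun u hu => (h1 u hu).mono hω, h2, h3⟩

theorem rayleigh_nonneg (ω : Set (ℝ × ℝ)) (u : ℝ × ℝ → ℝ) : 0 ≤ rayleigh ω u :=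
  div_nonneg (integral_nonneg fun _ => gradSq_nonneg _ _) (integral_nonneg fun _ => sq_nonneg _)

theorem dirichletEV_nonneg (ω : Set (ℝ × ℝ)) (k : ℕ) : 0 ≤ dirichletEV ω k := by
  refine Real.sInf_nonneg ?_
  rintro l ⟨V, -, -, rfl⟩
  refine Real.sSup_nonneg ?_
  rintro r ⟨u, -, -, rfl⟩
  exact rayleigh_nonneg ω u

theorem HasTrialSpace.dirichletEV_le {ω : Set (ℝ × ℝ)} {k : ℕ} {l : ℝ} (hk : 1 ≤ k)
    (h : HasTrialSpace ω k l) : dirichletEV ω k ≤ l := by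
  obtain ⟨V, h1, h2, h3⟩ := h
  have hV : V ≠ ⊥ := by
    rintro rfl
    simp at h2
    omega
  obtain ⟨v, hv, hv0⟩ := V.exists_mem_ne_zero_of_ne_bot hV
  calc dirichletEV ω k ≤ sSup {r | ∃ u ∈ V, u ≠ 0 ∧ r = rayleigh ω u} := by
        refine csInf_le ⟨0, ?_⟩ ⟨V, h1, h2, rfl⟩
        rintro l ⟨W, -, -, rfl⟩
        refine Real.sSup_nonneg ?_
        rintro r ⟨u, -, -, rfl⟩
        exact rayleigh_nonneg ω u
    _ ≤ l := by
        refine csSup_le ⟨_, v, hv, hv0, rfl⟩ ?_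
        rintro r ⟨u, hu, hu0, rfl⟩
        rw [(h1 u hu).rayleigh_eq, div_le_iff₀ ((h1 u hu).integral_sq_pos hu0)]
        exact h3 u hu

theorem hasTrialSpace_of_dirichletEV_lt {ω : Set (ℝ × ℝ)} {k : ℕ} {l l₀ : ℝ} (hk : 1 ≤ k)
    (h₀ : HasTrialSpace ω k l₀) (h : dirichletEV ω k < l) : HasTrialSpace ω k l := by
  obtain ⟨V₀, h1, h2, -⟩ := h₀
  obtain ⟨_, ⟨V, hV, hVk, rfl⟩, hl⟩ := exists_lt_of_csInf_lt (by exact ⟨_, V₀, h1, h2, rfl⟩) h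
  have : FiniteDimensional ℝ V := Module.finite_of_finrank_pos (by omega)
  refine ⟨V, hV, hVk, fun u hu => ?_⟩
  obtain ⟨C, hC⟩ := exists_integral_gradSq_le V hV
  rcases eq_or_ne u 0 with rfl | hu0
  · simp [gradSq]
  rw [← div_le_iff₀ ((hV hu).integral_sq_pos hu0), ← (hV hu).rayleigh_eq]
  refine le_trans (le_csSup ?_ (by exact ⟨u, hu, hu0, rfl⟩)) hl.le
  refine ⟨C, ?_⟩
  rintro r ⟨v, hv, hv0, rfl⟩
  rw [(hV hv).rayleigh_eq, div_le_iff₀ ((hV hv).integral_sq_pos hv0)]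
  exact hC v hv

/-- A set with nonempty interior carries trial spaces of every dimension. -/
theorem exists_hasTrialSpace {ω : Set (ℝ × ℝ)} {x₀ : ℝ × ℝ} (hω : ω ∈ nhds x₀)
    (k : ℕ) : ∃ l, HasTrialSpace ω k l := by
  obtain ⟨φ, hφω, hφc, hφ, -, hφ1⟩ := exists_contDiff_tsupport_subset (n := (⊤ : ℕ∞)) hω
  let A : Polynomial.degreeLT ℝ k →ₗ[ℝ] (ℝ × ℝ → ℝ) :=
    { toFun := fun p x => p.1.eval x.1 * φ x
      map_add' := fun p q => by ext x; simp [add_mul]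
      map_smul' := fun c p => by ext x; simp [mul_assoc] }
  have hA : Function.Injective A := by
    rw [injective_iff_map_eq_zero]
    intro p hp
    refine Subtype.ext (Polynomial.eq_zero_of_infinite_isRoot _ ?_)
    have hev : ∀ᶠ t in nhds x₀.1, φ (t, x₀.2) ≠ 0 := by
      have hc : Continuous fun t : ℝ => φ (t, x₀.2) := hφ.continuous.comp (by fun_prop)
      exact hc.continuousAt.eventually_ne (by simp [hφ1])
    refine (infinite_of_mem_nhds x₀.1 hev).mono fun t ht => ?_
    have := congrFun hp (t, x₀.2)
    exact (mul_eq_zero.1 this).resolve_right ht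
  have hfd : FiniteDimensional ℝ (Polynomial.degreeLT ℝ k) :=
    (Polynomial.degreeLTEquiv ℝ k).symm.finiteDimensional
  have hV : ∀ u ∈ LinearMap.range A, testFun ω u := by
    rintro _ ⟨p, rfl⟩
    refine ⟨?_, hφc.mul_left, (tsupport_mul_subset_right).trans hφω⟩
    exact ContDiff.mul (p.1.contDiff_aeval _ |>.comp contDiff_fst) hφ
  obtain ⟨C, hC⟩ := exists_integral_gradSq_le (LinearMap.range A) hV
  refine ⟨C, _, hV, ?_, hC⟩
  rw [LinearMap.finrank_range_of_inj hA, (Polynomial.degreeLTEquiv ℝ k).finrank_eq]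
  simp

theorem integral_fderiv_apply_eq_zero {g : ℝ × ℝ → ℝ} (hg : ContDiff ℝ 1 g)
    (hc : HasCompactSupport g) (v : ℝ × ℝ) : ∫ x, fderiv ℝ g x v = 0 := by
  have h := integral_mul_fderiv_eq_neg_fderiv_mul_of_integrable (μ := volume)
    (f := fun _ : ℝ × ℝ => (1 : ℝ)) (g := g) (v := v) (by simp) ?_ ?_ (by simp)
    fun x _ => hg.differentiable (by simp) x
  · simpa using h
  · simpa using ((hg.continuous_fderiv (by simp)).clm_apply
      continuous_const).integrable_of_hasCompactSupport (hc.fderiv_apply ℝ v)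
  · simpa using hg.continuous.integrable_of_hasCompactSupport hc

/-- A vector field `F` with `|F|² ≤ w ≤ div F` yields a Hardy inequality with weight `w`. -/
theorem testFun.integral_sq_mul_le {ω : Set (ℝ × ℝ)} {u F₁ F₂ w : ℝ × ℝ → ℝ} (hu : testFun ω u)
    (hF₁ : ContDiff ℝ 1 F₁) (hF₂ : ContDiff ℝ 1 F₂) (hw : Continuous w)
    (h_div : ∀ x ∈ ω, w x ≤ fderiv ℝ F₁ x (1, 0) + fderiv ℝ F₂ x (0, 1))
    (h_le : ∀ x ∈ ω, F₁ x ^ 2 + F₂ x ^ 2 ≤ w x) :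
    ∫ x, u x ^ 2 * w x ≤ 4 * ∫ x, gradSq u x := by
  have hu1 : ContDiff ℝ 1 u := hu.1.of_le (by exact_mod_cast le_top)
  have hc (F : ℝ × ℝ → ℝ) : HasCompactSupport fun x => u x ^ 2 * F x :=
    HasCompactSupport.intro hu.2.1 fun x hx => by simp [image_eq_zero_of_notMem_tsupport hx]
  have hd (F : ℝ × ℝ → ℝ) (hF : ContDiff ℝ 1 F) (x v : ℝ × ℝ) :
      fderiv ℝ (fun x => u x ^ 2 * F x) x v =
        u x ^ 2 * fderiv ℝ F x v + F x * (2 * u x * fderiv ℝ u x v) := by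
    have h := ((hu.differentiable x).hasFDerivAt.pow 2).mul
      (hF.differentiable (by simp) x).hasFDerivAt
    have h' := HasFDerivAt.fderiv (f := fun x => u x ^ 2 * F x) h
    rw [h']
    simp
  have hi (F : ℝ × ℝ → ℝ) (hF : ContDiff ℝ 1 F) (v : ℝ × ℝ) :
      Integrable fun x => fderiv ℝ (fun x => u x ^ 2 * F x) x v :=
    ((((hu1.pow 2).mul hF).continuous_fderiv (by simp)).clm_apply
      continuous_const).integrable_of_hasCompactSupport ((hc F).fderiv_apply ℝ v)
  have h1 := integral_fderiv_apply_eq_zero ((hu1.pow 2).mul hF₁) (hc F₁) (1, 0)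
  have h2 := integral_fderiv_apply_eq_zero ((hu1.pow 2).mul hF₂) (hc F₂) (0, 1)
  have hwi : Integrable fun x => u x ^ 2 * w x :=
    ((hu.1.continuous.pow 2).mul hw).integrable_of_hasCompactSupport (hc w)
  have key : ∫ x, (u x ^ 2 * w x - 4 * gradSq u x) ≤
      ∫ x, 2 * (fderiv ℝ (fun x => u x ^ 2 * F₁ x) x (1, 0) +
        fderiv ℝ (fun x => u x ^ 2 * F₂ x) x (0, 1)) := by
    refine integral_mono (hwi.sub (hu.integrable_gradSq.const_mul 4))
      (((hi F₁ hF₁ _).add (hi F₂ hF₂ _)).const_mul 2) fun x => ?_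
    simp only [hd F₁ hF₁, hd F₂ hF₂, gradSq]
    rcases eq_or_ne (u x) 0 with h0 | h0
    · simp only [h0]; nlinarith [sq_nonneg (fderiv ℝ u x (1, 0)), sq_nonneg (fderiv ℝ u x (0, 1))]
    have hx := hu.2.2 (subset_tsupport u h0)
    nlinarith [mul_le_mul_of_nonneg_left (h_div x hx) (sq_nonneg (u x)),
      mul_le_mul_of_nonneg_left (h_le x hx) (sq_nonneg (u x)),
      sq_nonneg (u x * F₁ x + 2 * fderiv ℝ u x (1, 0)),
      sq_nonneg (u x * F₂ x + 2 * fderiv ℝ u x (0, 1))]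
  rw [integral_sub hwi (hu.integrable_gradSq.const_mul 4), integral_const_mul,
    integral_const_mul, integral_add (hi F₁ hF₁ _) (hi F₂ hF₂ _), h1, h2] at key
  linarith

/-- The squared distance to `p`, regularized by `τ²`. -/
def regSqDist (p : ℝ × ℝ) (τ : ℝ) (x : ℝ × ℝ) : ℝ :=
  (x.1 - p.1) ^ 2 + (x.2 - p.2) ^ 2 + τ ^ 2

theorem regSqDist_pos (p : ℝ × ℝ) {τ : ℝ} (hτ : 0 < τ) (x : ℝ × ℝ) : 0 < regSqDist p τ x := by
  unfold regSqDist; positivity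

theorem contDiff_regSqDist (p : ℝ × ℝ) (τ : ℝ) {n : WithTop ℕ∞} :
    ContDiff ℝ n (regSqDist p τ) := by
  unfold regSqDist; fun_prop

theorem fderiv_comp_regSqDist {p : ℝ × ℝ} {τ : ℝ} {φ : ℝ → ℝ} {φ' : ℝ} {x : ℝ × ℝ}
    (hφ : HasDerivAt φ φ' (regSqDist p τ x)) (v : ℝ × ℝ) :
    fderiv ℝ (fun y => φ (regSqDist p τ y)) x v =
      φ' * (2 * (x.1 - p.1) * v.1 + 2 * (x.2 - p.2) * v.2) := by
  have h1 : HasFDerivAt (fun y : ℝ × ℝ => y.1 - p.1) (ContinuousLinearMap.fst ℝ ℝ ℝ) x :=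
    hasFDerivAt_fst.sub_const _
  have h2 : HasFDerivAt (fun y : ℝ × ℝ => y.2 - p.2) (ContinuousLinearMap.snd ℝ ℝ ℝ) x :=
    hasFDerivAt_snd.sub_const _
  have h3 := ((h1.pow 2).add (h2.pow 2)).add_const (τ ^ 2)
  have h4 := hφ.comp_hasFDerivAt x (f := regSqDist p τ) h3
  rw [HasFDerivAt.fderiv (f := fun y => φ (regSqDist p τ y)) h4]
  simp
  ring

/-- The radial profile of the vector field behind the logarithmic Hardy inequality. -/
def hardyProfile (L s : ℝ) : ℝ := (L - log s) / (s * (1 + (L - log s) ^ 2))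

theorem hasDerivAt_hardyProfile (L : ℝ) {s : ℝ} (hs : 0 < s) :
    HasDerivAt (hardyProfile L)
      (((L - log s) ^ 2 - 1 - (L - log s) * (1 + (L - log s) ^ 2)) /
        (s ^ 2 * (1 + (L - log s) ^ 2) ^ 2)) s := by
  have h1 : HasDerivAt (fun t => L - log t) (-s⁻¹) s :=
    (hasDerivAt_log hs.ne').const_sub L
  have h0 : s * (1 + (L - log s) ^ 2) ≠ 0 := by positivity
  have h2 : HasDerivAt (hardyProfile L) _ s :=
    h1.div ((hasDerivAt_id s).mul ((h1.pow 2).const_add 1)) h0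
  refine h2.congr_deriv ?_
  simp only [id]
  field_simp
  ring

theorem contDiffAt_log_sub (L : ℝ) {s : ℝ} (hs : 0 < s) {n : WithTop ℕ∞} :
    ContDiffAt ℝ n (fun t => L - log t) s :=
  contDiffAt_const.sub (contDiffAt_log.2 hs.ne')

theorem contDiffAt_hardyProfile (L : ℝ) {s : ℝ} (hs : 0 < s) {n : WithTop ℕ∞} :
    ContDiffAt ℝ n (hardyProfile L) s :=
  (contDiffAt_log_sub L hs).div
    (contDiffAt_id.mul (contDiffAt_const.add ((contDiffAt_log_sub L hs).pow 2)))
    (by positivity)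

/-- The weight of the regularized logarithmic Hardy inequality. -/
def hardyWeight (p : ℝ × ℝ) (τ L : ℝ) (x : ℝ × ℝ) : ℝ :=
  1 / (regSqDist p τ x * (1 + (L - log (regSqDist p τ x)) ^ 2))

theorem continuous_log_regSqDist (p : ℝ × ℝ) {τ : ℝ} (hτ : 0 < τ) :
    Continuous fun x => log (regSqDist p τ x) :=
  (contDiff_regSqDist p τ (n := 0)).continuous.log fun x => (regSqDist_pos p hτ x).ne'

theorem continuous_hardyWeight (p : ℝ × ℝ) {τ : ℝ} (hτ : 0 < τ) (L : ℝ) :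
    Continuous (hardyWeight p τ L) := by
  refine continuous_const.div ((contDiff_regSqDist p τ (n := 0)).continuous.mul
    (continuous_const.add ((continuous_const.sub (continuous_log_regSqDist p hτ)).pow 2)))
    fun x => ?_
  have := regSqDist_pos p hτ x
  positivity

theorem hardyProfile_sq_le (p : ℝ × ℝ) {τ : ℝ} (hτ : 0 < τ) (L : ℝ) (x : ℝ × ℝ) :
    ((x.1 - p.1) ^ 2 + (x.2 - p.2) ^ 2) * hardyProfile L (regSqDist p τ x) ^ 2 ≤
      hardyWeight p τ L x := by
  have hs := regSqDist_pos p hτ x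
  have hr : (x.1 - p.1) ^ 2 + (x.2 - p.2) ^ 2 ≤ regSqDist p τ x := by
    unfold regSqDist; nlinarith
  unfold hardyProfile hardyWeight
  set s := regSqDist p τ x
  set m := L - log s
  rw [div_pow, ← mul_div_assoc, div_le_div_iff₀ (by positivity) (by positivity)]
  calc ((x.1 - p.1) ^ 2 + (x.2 - p.2) ^ 2) * m ^ 2 * (s * (1 + m ^ 2))
      ≤ s * (1 + m ^ 2) * (s * (1 + m ^ 2)) := by
        gcongr
        linarith
    _ = 1 * (s * (1 + m ^ 2)) ^ 2 := by ring

/-- The logarithmic Hardy inequality in the plane, in regularized form. -/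
theorem testFun.integral_sq_mul_hardyWeight_le {ω : Set (ℝ × ℝ)} {u : ℝ × ℝ → ℝ}
    (hu : testFun ω u) (p : ℝ × ℝ) {τ L : ℝ} (hτ : 0 < τ)
    (hL : ∀ x ∈ ω, 2 ≤ L - log (regSqDist p τ x)) :
    ∫ x, u x ^ 2 * hardyWeight p τ L x ≤ 4 * ∫ x, gradSq u x := by
  have hφ : ContDiff ℝ 1 fun x => hardyProfile L (regSqDist p τ x) :=
    contDiff_iff_contDiffAt.2 fun x =>
      (contDiffAt_hardyProfile L (regSqDist_pos p hτ x)).comp x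
        (contDiff_regSqDist p τ).contDiffAt
  refine hu.integral_sq_mul_le
    (F₁ := fun x => (x.1 - p.1) * hardyProfile L (regSqDist p τ x))
    (F₂ := fun x => (x.2 - p.2) * hardyProfile L (regSqDist p τ x))
    ((contDiff_fst.sub contDiff_const).mul hφ) ((contDiff_snd.sub contDiff_const).mul hφ)
    (continuous_hardyWeight p hτ L) (fun x hx => ?_) fun x _ => ?_
  · have hφx := (hφ.differentiable (by simp) x).hasFDerivAt
    have e1 := HasFDerivAt.fderiv ((hasFDerivAt_fst.sub_const p.1 : HasFDerivAt
      (fun y : ℝ × ℝ => y.1 - p.1) (ContinuousLinearMap.fst ℝ ℝ ℝ) x).mul hφx)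
    have e2 := HasFDerivAt.fderiv ((hasFDerivAt_snd.sub_const p.2 : HasFDerivAt
      (fun y : ℝ × ℝ => y.2 - p.2) (ContinuousLinearMap.snd ℝ ℝ ℝ) x).mul hφx)
    have hs := regSqDist_pos p hτ x
    have hd := hasDerivAt_hardyProfile L hs
    have hm := hL x hx
    rw [show (fun x : ℝ × ℝ => (x.1 - p.1) * hardyProfile L (regSqDist p τ x)) =
      (fun y : ℝ × ℝ => y.1 - p.1) * fun x => hardyProfile L (regSqDist p τ x) from rfl,
      show (fun x : ℝ × ℝ => (x.2 - p.2) * hardyProfile L (regSqDist p τ x)) =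
      (fun y : ℝ × ℝ => y.2 - p.2) * fun x => hardyProfile L (regSqDist p τ x) from rfl,
      e1, e2]
    simp only [add_apply, smul_apply,
      fderiv_comp_regSqDist hd, ContinuousLinearMap.coe_fst',
      ContinuousLinearMap.coe_snd', smul_eq_mul]
    have hr : regSqDist p τ x = (x.1 - p.1) ^ 2 + (x.2 - p.2) ^ 2 + τ ^ 2 := rfl
    unfold hardyWeight hardyProfile
    set s := regSqDist p τ x
    set m := L - log s
    have e : 1 / (s * (1 + m ^ 2)) = s * (1 + m ^ 2) / (s ^ 2 * (1 + m ^ 2) ^ 2) := by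
      field_simp
    have e' : m / (s * (1 + m ^ 2)) = m * s * (1 + m ^ 2) / (s ^ 2 * (1 + m ^ 2) ^ 2) := by
      field_simp
    rw [e, e']
    set D := s ^ 2 * (1 + m ^ 2) ^ 2
    have hD : 0 < D := by positivity
    rw [← sub_nonneg]
    have : (2 * m * s * (1 + m ^ 2) + 2 * ((x.1 - p.1) ^ 2 + (x.2 - p.2) ^ 2) *
        (m ^ 2 - 1 - m * (1 + m ^ 2)) - s * (1 + m ^ 2)) / D ≥ 0 := by
      apply div_nonneg _ hD.le
      rw [hr]
      have h3 : 0 ≤ (2 * m - 1) * (τ ^ 2 * (1 + m ^ 2)) :=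
        mul_nonneg (by linarith) (by positivity)
      have h4 : 0 ≤ (m ^ 2 - 3) * ((x.1 - p.1) ^ 2 + (x.2 - p.2) ^ 2) :=
        mul_nonneg (by nlinarith) (by positivity)
      linarith
    refine this.trans_eq ?_
    ring
  · refine le_trans (le_of_eq ?_) (hardyProfile_sq_le p hτ L x)
    ring

theorem exists_abs_deriv_smoothTransition_le : ∃ C > 0, ∀ t, |deriv smoothTransition t| ≤ C := by
  have hc : Continuous (deriv smoothTransition) :=
    (smoothTransition.contDiff (n := 1)).continuous_deriv (by simp)
  obtain ⟨C, hC⟩ := isCompact_Icc.exists_bound_of_continuousOn (s := Icc (0 : ℝ) 1) hc.continuousOn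
  refine ⟨max C 1, by positivity, fun t => ?_⟩
  rcases lt_or_ge t 0 with h0 | h0
  · have : smoothTransition =ᶠ[nhds t] fun _ => 0 := by
      filter_upwards [Iio_mem_nhds h0] with s hs using smoothTransition.zero_of_nonpos (le_of_lt hs)
    rw [this.deriv_eq]
    simp
  rcases lt_or_ge 1 t with h1 | h1
  · have : smoothTransition =ᶠ[nhds t] fun _ => 1 := by
      filter_upwards [Ioi_mem_nhds h1] with s hs using smoothTransition.one_of_one_le (le_of_lt hs)
    rw [this.deriv_eq]
    simp
  · exact (hC t ⟨h0, h1⟩).trans (le_max_left _ _)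

theorem exists_mul_exp_neg_le (L : ℝ) {κ : ℝ} (hκ : 0 < κ) :
    ∃ m₁ ≥ 0, ∀ m ≥ m₁, exp (L - m) * (1 + m ^ 2) ≤ κ := by
  have h := ((tendsto_pow_mul_exp_neg_atTop_nhds_zero 0).add
    (tendsto_pow_mul_exp_neg_atTop_nhds_zero 2)).const_mul (exp L)
  rw [add_zero, mul_zero] at h
  obtain ⟨m₁, hm₁⟩ := Filter.eventually_atTop.1 (h.eventually_le_const hκ)
  refine ⟨max m₁ 0, le_max_right _ _, fun m hm => ?_⟩
  refine le_trans (le_of_eq ?_) (hm₁ m ((le_max_left _ _).trans hm))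
  rw [sub_eq_add_neg, exp_add]
  ring

/-- A cutoff function vanishing near `p`, with small effect on energies and norms. -/
theorem exists_cutoff (p : ℝ × ℝ) (R : ℝ) {κ : ℝ} (hκ : 0 < κ) :
    ∃ η : ℝ × ℝ → ℝ, ContDiff ℝ (⊤ : ℕ∞) η ∧ (∀ x, 0 ≤ η x ∧ η x ≤ 1) ∧
      (∃ ρ > 0, Disjoint (tsupport η) (Metric.closedBall p ρ)) ∧
      ∀ ω ⊆ disk R, ∀ u, testFun ω u →
        ∫ x, u x ^ 2 * gradSq η x ≤ κ * ∫ x, gradSq u x ∧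
        ∫ x, u x ^ 2 * (1 - η x ^ 2) ≤ κ * ∫ x, gradSq u x := by
  obtain ⟨C, hC0, hC⟩ := exists_abs_deriv_smoothTransition_le
  set K : ℝ := 2 * R ^ 2 + 2 * (p.1 ^ 2 + p.2 ^ 2) + 1 with hK
  have hK1 : 1 ≤ K := by rw [hK]; nlinarith [sq_nonneg R, sq_nonneg p.1, sq_nonneg p.2]
  set L : ℝ := 2 + log K with hLdef
  have hL2 : 2 ≤ L := by linarith [log_nonneg hK1]
  obtain ⟨m₁, hm₁0, hm₁⟩ := exists_mul_exp_neg_le L (show 0 < κ / 4 by positivity)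
  set M : ℝ := 64 * C ^ 2 / κ + 1 with hM
  have hM0 : 0 < M := by positivity
  have hMC : 16 * C ^ 2 / M ^ 2 ≤ κ / 4 := by
    rw [div_le_iff₀ (by positivity)]
    have h1 : 64 * C ^ 2 / κ ≤ M ^ 2 := by
      have : 0 ≤ 64 * C ^ 2 / κ := by positivity
      nlinarith
    rw [div_le_iff₀ hκ] at h1
    linarith
  set a : ℝ := log (1 + m₁ ^ 2) with ha
  set b : ℝ := a + M with hb
  set τ : ℝ := exp (-exp b) with hτdef
  have hτ : 0 < τ := exp_pos _
  have hτ1 : τ ≤ 1 := exp_le_one_iff.2 (by linarith [exp_pos b])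
  set ℓ : ℝ × ℝ → ℝ := fun x => L - log (regSqDist p τ x) with hℓ
  have hs (x : ℝ × ℝ) : 0 < regSqDist p τ x := regSqDist_pos p hτ x
  have hℓp (x : ℝ × ℝ) : 0 < 1 + ℓ x ^ 2 := by positivity
  set η : ℝ × ℝ → ℝ := fun x => smoothTransition ((b - log (1 + ℓ x ^ 2)) / M) with hη
  have hℓs : ContDiff ℝ (⊤ : ℕ∞) ℓ :=
    contDiff_const.sub ((contDiff_regSqDist p τ).log fun x => (hs x).ne')
  have hZs : ContDiff ℝ (⊤ : ℕ∞) fun x => log (1 + ℓ x ^ 2) :=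
    (contDiff_const.add (hℓs.pow 2)).log fun x => (hℓp x).ne'
  have hηs : ContDiff ℝ (⊤ : ℕ∞) η :=
    smoothTransition.contDiff.comp ((contDiff_const.sub hZs).div_const M)
  have hη01 (x : ℝ × ℝ) : 0 ≤ η x ∧ η x ≤ 1 :=
    ⟨smoothTransition.nonneg _, smoothTransition.le_one _⟩
  have hgrad (x : ℝ × ℝ) : gradSq η x ≤ κ / 4 * hardyWeight p τ L x := by
    have h1 : HasDerivAt (fun t => L - log t) (-(regSqDist p τ x)⁻¹) (regSqDist p τ x) :=
      (hasDerivAt_log (hs x).ne').const_sub L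
    have h2 : HasDerivAt (fun t => (b - log (1 + (L - log t) ^ 2)) / M) _ (regSqDist p τ x) :=
      (((h1.pow 2).const_add 1).log (hℓp x).ne').const_sub b |>.div_const M
    have h3 := ((smoothTransition.contDiff (n := 1)).differentiable (by simp)
      ((b - log (1 + (L - log (regSqDist p τ x)) ^ 2)) / M)).hasDerivAt
    have h3 : HasDerivAt (fun t => smoothTransition ((b - log (1 + (L - log t) ^ 2)) / M)) _
        (regSqDist p τ x) := HasDerivAt.comp (h₂ := smoothTransition) (regSqDist p τ x) h3 h2
    have h4 := fderiv_comp_regSqDist h3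
    have h5 : gradSq η x = 16 * deriv smoothTransition ((b - log (1 + ℓ x ^ 2)) / M) ^ 2 / M ^ 2 *
        (((x.1 - p.1) ^ 2 + (x.2 - p.2) ^ 2) * hardyProfile L (regSqDist p τ x) ^ 2) := by
      have e (v : ℝ × ℝ) : fderiv ℝ η x v = 2 *
          deriv smoothTransition ((b - log (1 + ℓ x ^ 2)) / M) / M *
          hardyProfile L (regSqDist p τ x) * (2 * (x.1 - p.1) * v.1 + 2 * (x.2 - p.2) * v.2) := by
        refine (h4 v).trans ?_
        congr 1
        have := hs x
        have := hℓp x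
        simp only [hℓ, hardyProfile, Pi.pow_apply, Nat.cast_ofNat] at *
        field_simp
        ring_nf
      rw [gradSq, e, e]
      ring_nf
    rw [h5]
    have hC' : deriv smoothTransition ((b - log (1 + ℓ x ^ 2)) / M) ^ 2 ≤ C ^ 2 :=
      sq_le_sq' (abs_le.1 (hC _)).1 (abs_le.1 (hC _)).2
    calc _ ≤ (16 * C ^ 2 / M ^ 2) * hardyWeight p τ L x := by
          gcongr
          exact hardyProfile_sq_le p hτ L x
      _ ≤ _ := by
          gcongr
          exact one_div_nonneg.2 (by have := hs x; positivity)
  have hℓ2 : ∀ x ∈ disk R, 2 ≤ ℓ x := by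
    intro x hx
    have hx' : x.1 ^ 2 + x.2 ^ 2 < R ^ 2 := hx
    have : regSqDist p τ x ≤ K := by
      unfold regSqDist
      nlinarith [sq_nonneg (x.1 + p.1), sq_nonneg (x.2 + p.2)]
    have := log_le_log (hs x) this
    simp only [hℓ]
    linarith
  have hmass : ∀ x ∈ disk R, 1 - η x ^ 2 ≤ κ / 4 * hardyWeight p τ L x := by
    intro x hx
    have hw : 0 < hardyWeight p τ L x := one_div_pos.2 (by have := hs x; positivity)
    by_cases h1 : 1 ≤ (b - log (1 + ℓ x ^ 2)) / M
    · have : η x = 1 := smoothTransition.one_of_one_le h1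
      rw [this]
      have : 0 ≤ κ / 4 * hardyWeight p τ L x := by positivity
      linarith
    · rw [not_le, div_lt_iff₀ hM0] at h1
      have h2 : a < log (1 + ℓ x ^ 2) := by linarith
      have h3 := (log_lt_log_iff (by positivity) (hℓp x)).1 h2
      have h4 : m₁ ≤ ℓ x := (abs_le_of_sq_le_sq' (by linarith) (by linarith [hℓ2 x hx])).2
      have h5 := hm₁ (ℓ x) h4
      have h6 : exp (L - ℓ x) = regSqDist p τ x := by
        simp only [hℓ, sub_sub_cancel]
        exact exp_log (hs x)
      rw [h6] at h5
      have h7 : 1 ≤ κ / 4 * hardyWeight p τ L x := by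
        unfold hardyWeight
        rw [mul_one_div, one_le_div (mul_pos (hs x) (hℓp x))]
        exact h5
      nlinarith [sq_nonneg (η x)]
  refine ⟨η, hηs, hη01, ?_, fun ω hω u hu => ?_⟩
  · have hopen : IsOpen {x | b < log (1 + ℓ x ^ 2)} := isOpen_lt continuous_const hZs.continuous
    have hp : p ∈ {x | b < log (1 + ℓ x ^ 2)} := by
      have h1 : ℓ p = L + 2 * exp b := by
        simp only [hℓ, regSqDist, hτdef, sub_self]
        simp
      rw [mem_ofPred_eq, lt_log_iff_exp_lt (hℓp p), h1]
      nlinarith [exp_pos b]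
    obtain ⟨ρ, hρ, hsub⟩ := Metric.nhds_basis_closedBall.mem_iff.1 (hopen.mem_nhds hp)
    refine ⟨ρ, hρ, ?_⟩
    have h0 : tsupport η ⊆ {x | b < log (1 + ℓ x ^ 2)}ᶜ := by
      refine closure_minimal (fun x hx hxb => hx ?_) hopen.isClosed_compl
      exact smoothTransition.zero_of_nonpos
        (div_nonpos_of_nonpos_of_nonneg (by simp only [mem_ofPred_eq] at hxb; linarith) hM0.le)
    exact (disjoint_compl_left).mono h0 hsub
  · have hwi : Integrable fun x => κ / 4 * (u x ^ 2 * hardyWeight p τ L x) :=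
      hu.integrable_of_continuous
        (continuous_const.mul ((hu.1.continuous.pow 2).mul (continuous_hardyWeight p hτ L)))
        fun x hx => by simp [image_eq_zero_of_notMem_tsupport hx]
    have hH := hu.integral_sq_mul_hardyWeight_le p hτ fun x hx => hℓ2 x (hω hx)
    have hH' : ∫ x, κ / 4 * (u x ^ 2 * hardyWeight p τ L x) ≤ κ * ∫ x, gradSq u x := by
      rw [integral_const_mul]
      calc _ ≤ κ / 4 * (4 * ∫ x, gradSq u x) := by gcongr
        _ = _ := by ring
    have hηg : Continuous (gradSq η) :=
      ((continuous_fderiv_apply_of_contDiff hηs _).pow 2).add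
        ((continuous_fderiv_apply_of_contDiff hηs _).pow 2)
    constructor
    · refine (integral_mono (hu.integrable_of_continuous ((hu.1.continuous.pow 2).mul hηg)
        fun x hx => by simp [image_eq_zero_of_notMem_tsupport hx]) hwi fun x => ?_).trans hH'
      have := mul_le_mul_of_nonneg_left (hgrad x) (sq_nonneg (u x))
      simp only [Pi.mul_apply, Pi.pow_apply]
      linarith
    · refine (integral_mono (hu.integrable_of_continuous ((hu.1.continuous.pow 2).mul
        (continuous_const.sub (hηs.continuous.pow 2)))
        fun x hx => by simp [image_eq_zero_of_notMem_tsupport hx]) hwi fun x => ?_).trans hH'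
      simp only [Pi.mul_apply, Pi.pow_apply, Pi.sub_apply]
      rcases eq_or_ne (u x) 0 with h0 | h0
      · simp [h0]
      have := mul_le_mul_of_nonneg_left (hmass x (hω (hu.2.2 (subset_tsupport u h0))))
        (sq_nonneg (u x))
      linarith

theorem testFun.mul_cutoff {ω s : Set (ℝ × ℝ)} {u η : ℝ × ℝ → ℝ} (hu : testFun ω u)
    (hη : ContDiff ℝ (⊤ : ℕ∞) η) (hs : Disjoint (tsupport η) s) : testFun (ω \ s) (η * u) :=
  ⟨hη.mul hu.1, hu.2.1.mul_left, fun _ hx => ⟨hu.2.2 (tsupport_mul_subset_right hx),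
    hs.notMem_of_mem_left (tsupport_mul_subset_left hx)⟩⟩

theorem testFun.integral_gradSq_mul_le {ω : Set (ℝ × ℝ)} {u η : ℝ × ℝ → ℝ} (hu : testFun ω u)
    (hη : ContDiff ℝ (⊤ : ℕ∞) η) (hη1 : ∀ x, 0 ≤ η x ∧ η x ≤ 1) {α : ℝ} (hα : 0 < α) :
    ∫ x, gradSq (η * u) x ≤
      (1 + α) * (∫ x, gradSq u x) + (1 + 1 / α) * ∫ x, u x ^ 2 * gradSq η x := by
  have hηg : Continuous (gradSq η) :=
    ((continuous_fderiv_apply_of_contDiff hη _).pow 2).add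
      ((continuous_fderiv_apply_of_contDiff hη _).pow 2)
  have hi : Integrable fun x => u x ^ 2 * gradSq η x :=
    hu.integrable_of_continuous ((hu.1.continuous.pow 2).mul hηg)
      fun x hx => by simp [image_eq_zero_of_notMem_tsupport hx]
  have hηu := hu.mul_cutoff hη (disjoint_empty _)
  rw [← integral_const_mul, ← integral_const_mul,
    ← integral_add (hu.integrable_gradSq.const_mul _) (hi.const_mul _)]
  refine integral_mono hηu.integrable_gradSq
    ((hu.integrable_gradSq.const_mul _).add (hi.const_mul _)) fun x => ?_
  have hd (v : ℝ × ℝ) : fderiv ℝ (η * u) x v = η x * fderiv ℝ u x v + u x * fderiv ℝ η x v := by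
    rw [fderiv_mul (hη.differentiable (by simp) x) (hu.differentiable x)]
    simp
  have young (a b : ℝ) : (a + b) ^ 2 ≤ (1 + α) * a ^ 2 + (1 + 1 / α) * b ^ 2 := by
    have : (1 + α) * a ^ 2 + (1 + 1 / α) * b ^ 2 - (a + b) ^ 2 = (α * a - b) ^ 2 / α := by
      field_simp
      ring
    have : 0 ≤ (α * a - b) ^ 2 / α := by positivity
    linarith
  have hle (e : ℝ) : (1 + α) * (η x * e) ^ 2 ≤ (1 + α) * e ^ 2 := by
    rw [mul_pow]
    have : η x ^ 2 ≤ 1 := pow_le_one₀ (hη1 x).1 (hη1 x).2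
    gcongr
    nlinarith [sq_nonneg e]
  simp only [gradSq, hd]
  have h1 := young (η x * fderiv ℝ u x (1, 0)) (u x * fderiv ℝ η x (1, 0))
  have h2 := young (η x * fderiv ℝ u x (0, 1)) (u x * fderiv ℝ η x (0, 1))
  have h3 := hle (fderiv ℝ u x (1, 0))
  have h4 := hle (fderiv ℝ u x (0, 1))
  linarith

/-- Removing a small closed ball raises trial energies by an arbitrarily small amount: points
have zero capacity in the plane. -/
theorem exists_hasTrialSpace_diff_closedBall (p : ℝ × ℝ) (R : ℝ) {l δ : ℝ} (hl : 0 ≤ l)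
    (hδ : 0 < δ) : ∃ ρ > 0, ∀ ω ⊆ disk R, ∀ k, HasTrialSpace ω k l →
      HasTrialSpace (ω \ Metric.closedBall p ρ) k (l + δ) := by
  set d : ℝ := 3 * l + (l + δ) * l + δ with hd
  have hd0 : 0 < d := by positivity
  obtain ⟨α, hα⟩ : ∃ α, α = δ / d := ⟨_, rfl⟩
  have hα0 : 0 < α := by rw [hα]; positivity
  have hαd : α * d = δ := by rw [hα]; field_simp
  have hα1 : α ≤ 1 := by
    rw [hα, div_le_one hd0]
    nlinarith [mul_nonneg (add_nonneg hl hδ.le) hl]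
  have hαl : α * l < 1 := by
    rw [hα, div_mul_eq_mul_div, div_lt_one hd0]
    nlinarith
  obtain ⟨η, hηs, hη1, ⟨ρ, hρ, hdisj⟩, hη⟩ := exists_cutoff p R (pow_pos hα0 2)
  refine ⟨ρ, hρ, fun ω hω k ⟨V, hV, hVk, hVl⟩ => ?_⟩
  have hα2 : α ^ 2 * l ≤ α * l := by
    gcongr
    nlinarith
  have hQ : ∀ u ∈ V, (1 - α * l) * ∫ x, u x ^ 2 ≤ ∫ x, (η * u) x ^ 2 := by
    intro u hu
    have h1 := (hη ω hω u (hV u hu)).2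
    have h2 : ∫ x, u x ^ 2 * (1 - η x ^ 2) = (∫ x, u x ^ 2) - ∫ x, (η * u) x ^ 2 := by
      rw [← integral_sub (hV u hu).integrable_sq
        ((hV u hu).mul_cutoff hηs hdisj).integrable_sq]
      congr 1
      ext x
      simp only [Pi.mul_apply]
      ring
    have h3 := mul_le_mul_of_nonneg_left (hVl u hu) (sq_nonneg α)
    have h4 : 0 ≤ ∫ x, u x ^ 2 := integral_nonneg fun _ => sq_nonneg _
    have h5 := mul_le_mul_of_nonneg_right hα2 h4
    linarith
  let A : V →ₗ[ℝ] (ℝ × ℝ → ℝ) := (LinearMap.mulLeft ℝ η).domRestrict V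
  have hA : Function.Injective A := by
    rw [injective_iff_map_eq_zero]
    intro u hu
    by_contra h0
    have h1 := hQ u u.2
    rw [show η * u.1 = 0 from hu] at h1
    have h2 := (hV u u.2).integral_sq_pos fun h => h0 (Subtype.ext h)
    have h3 : 0 < (1 - α * l) * ∫ x, u.1 x ^ 2 := mul_pos (by linarith) h2
    simp at h1
    linarith
  refine ⟨LinearMap.range A, ?_, by rw [LinearMap.finrank_range_of_inj hA, hVk], ?_⟩
  · rintro _ ⟨u, rfl⟩
    exact (hV u u.2).mul_cutoff hηs hdisj
  · rintro _ ⟨⟨u, hu⟩, rfl⟩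
    change ∫ x, gradSq (η * u) x ≤ (l + δ) * ∫ x, (η * u) x ^ 2
    have hu' := hV u hu
    have h1 := hu'.integral_gradSq_mul_le hηs hη1 hα0
    have h2 := (hη ω hω u hu').1
    have h3 := hVl u hu
    have h4 := hQ u hu
    set E := ∫ x, gradSq u x
    set Q := ∫ x, u x ^ 2
    have hE0 : 0 ≤ E := integral_nonneg fun _ => gradSq_nonneg _ _
    have hQ0 : 0 ≤ Q := integral_nonneg fun _ => sq_nonneg _
    calc ∫ x, gradSq (η * u) x ≤ (1 + α) * E + (1 + 1 / α) * (α ^ 2 * E) := by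
          refine h1.trans ?_
          gcongr
      _ = (1 + 2 * α + α ^ 2) * E := by field_simp; ring
      _ ≤ (1 + 3 * α) * (l * Q) := by
          gcongr ?_ * ?_
          nlinarith
      _ ≤ (l + δ) * ((1 - α * l) * Q) := by
          have : (1 + 3 * α) * l ≤ (l + δ) * (1 - α * l) := by
            rw [hd] at hαd
            nlinarith
          nlinarith
      _ ≤ _ := by gcongr

theorem exists_hasTrialSpace_diff_iUnion_closedBall (P : Finset (ℝ × ℝ)) (R : ℝ) {l δ : ℝ}
    (hl : 0 ≤ l) (hδ : 0 < δ) : ∃ ρ > 0, ∀ ω ⊆ disk R, ∀ k, HasTrialSpace ω k l →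
      HasTrialSpace (ω \ ⋃ p ∈ P, Metric.closedBall p ρ) k (l + δ) := by
  classical
  induction P using Finset.induction_on generalizing l δ with
  | empty =>
    refine ⟨1, one_pos, fun ω _ k ⟨V, hV, hVk, hVl⟩ => ⟨V, by simpa using hV, hVk, fun u hu => ?_⟩⟩
    refine (hVl u hu).trans ?_
    have : 0 ≤ ∫ x, u x ^ 2 := integral_nonneg fun _ => sq_nonneg _
    gcongr
    linarith
  | insert p P _ ih =>
    obtain ⟨ρ₁, hρ₁, h₁⟩ := ih hl (half_pos hδ)
    obtain ⟨ρ₂, hρ₂, h₂⟩ :=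
      exists_hasTrialSpace_diff_closedBall p R (add_nonneg hl (half_pos hδ).le) (half_pos hδ)
    refine ⟨min ρ₁ ρ₂, lt_min hρ₁ hρ₂, fun ω hω k h => ?_⟩
    have h' := h₂ _ (sdiff_subset.trans hω) k (h₁ ω hω k h)
    rw [add_assoc, add_halves] at h'
    refine h'.mono ?_
    rw [Finset.set_biUnion_insert, sdiff_sdiff, union_comm]
    refine sdiff_subset_sdiff_right (union_subset_union ?_ ?_)
    · exact Metric.closedBall_subset_closedBall (min_le_right _ _)
    · exact iUnion₂_mono fun q _ => Metric.closedBall_subset_closedBall (min_le_left _ _)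

/-- A trial space on a directed union of open sets lives on one of them. -/
theorem HasTrialSpace.exists_of_subset_iUnion {ι : Type*} [Nonempty ι] {U : ι → Set (ℝ × ℝ)}
    (hU : ∀ i, IsOpen (U i)) (hdir : Directed (· ⊆ ·) U) {ω : Set (ℝ × ℝ)} {k : ℕ} {l : ℝ}
    (hk : 1 ≤ k) (h : HasTrialSpace ω k l) (hω : ω ⊆ ⋃ i, U i) :
    ∃ i, HasTrialSpace (U i) k l := by
  obtain ⟨V, hV, hVk, hVl⟩ := h
  have : FiniteDimensional ℝ V := Module.finite_of_finrank_pos (by omega)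
  let b := Module.finBasis ℝ V
  have hK : IsCompact (⋃ j, tsupport (b j).1) :=
    isCompact_iUnion fun j => (hV _ (b j).2).2.1
  obtain ⟨i, hi⟩ := hK.elim_directed_cover U hU
    ((iUnion_subset fun j => (hV _ (b j).2).2.2).trans hω) hdir
  refine ⟨i, V, fun u hu => ⟨(hV u hu).1, (hV u hu).2.1, subset_trans ?_ hi⟩, hVk, hVl⟩
  refine closure_minimal (fun x hx => ?_) hK.isClosed
  by_contra hxK
  simp only [mem_iUnion, not_exists] at hxK
  refine hx ?_
  have hsum : ((∑ i, b.repr ⟨u, hu⟩ i • b i : V) : ℝ × ℝ → ℝ) = u :=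
    congrArg Subtype.val (b.sum_repr ⟨u, hu⟩)
  refine (congrFun hsum x).symm.trans ?_
  rw [AddSubmonoidClass.coe_finsetSum, Finset.sum_apply]
  refine Finset.sum_eq_zero fun j _ => ?_
  simp [image_eq_zero_of_notMem_tsupport (hxK j)]

theorem isOpen_disk (R : ℝ) : IsOpen (disk R) :=
  isOpen_lt (by fun_prop) continuous_const

theorem disk_subset_disk {R₁ R₂ : ℝ} (hR₁ : 0 < R₁) (h : R₁ ≤ R₂) : disk R₁ ⊆ disk R₂ := by
  intro x hx
  have hx' : x.1 ^ 2 + x.2 ^ 2 < R₁ ^ 2 := hx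
  change x.1 ^ 2 + x.2 ^ 2 < R₂ ^ 2
  nlinarith

theorem polar_mem_disk {R₁ R₂ : ℝ} (hR₁ : 0 < R₁) (h : R₁ < R₂) (θ : ℝ) :
    ((R₁ * cos θ, R₁ * sin θ) : ℝ × ℝ) ∈ disk R₂ := by
  change (R₁ * cos θ) ^ 2 + (R₁ * sin θ) ^ 2 < R₂ ^ 2
  rw [mul_pow, mul_pow, ← mul_add, cos_sq_add_sin_sq, mul_one]
  gcongr

theorem mem_diskUnionAnnulus {R₁ R₂ : ℝ} {x : ℝ × ℝ} (hx : x ∈ disk R₂)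
    (h : x.1 ^ 2 + x.2 ^ 2 ≠ R₁ ^ 2) : x ∈ diskUnionAnnulus R₁ R₂ := by
  rcases lt_or_gt_of_ne h with h | h
  · exact Or.inl h
  · refine Or.inr ⟨hx, fun hx' => ?_⟩
    have hcl : closure (disk R₁) ⊆ {x | x.1 ^ 2 + x.2 ^ 2 ≤ R₁ ^ 2} := by
      refine closure_minimal (fun y hy => ?_) (isClosed_le (by fun_prop) continuous_const)
      have hy' : y.1 ^ 2 + y.2 ^ 2 < R₁ ^ 2 := hy
      exact hy'.le
    exact absurd (hcl hx') (not_le.2 h)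

theorem isOpen_diskUnionAnnulus (R₁ R₂ : ℝ) : IsOpen (diskUnionAnnulus R₁ R₂) :=
  (isOpen_disk R₁).union ((isOpen_disk R₂).sdiff isClosed_closure)

theorem crackedDomain_subset_disk {R₁ R₂ : ℝ} (hR₁ : 0 < R₁) (h : R₁ < R₂) (N : ℕ) (ε : ℝ) :
    crackedDomain R₁ R₂ N ε ⊆ disk R₂ := by
  refine union_subset (union_subset (disk_subset_disk hR₁ h.le) sdiff_subset) ?_
  refine iUnion₂_subset fun j _ => ?_
  rintro _ ⟨θ, -, rfl⟩
  exact polar_mem_disk hR₁ h θ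

theorem crackedDomain_mono (R₁ R₂ : ℝ) (N : ℕ) : Monotone (crackedDomain R₁ R₂ N) := by
  intro ε ε' h
  refine union_subset_union_right _ (iUnion₂_mono fun j _ => ?_)
  rintro _ ⟨θ, hθ, rfl⟩
  exact ⟨θ, ⟨by linarith [hθ.1], by linarith [hθ.2]⟩, rfl⟩

theorem crackedDomain_zero (R₁ R₂ : ℝ) (N : ℕ) :
    crackedDomain R₁ R₂ N 0 = diskUnionAnnulus R₁ R₂ := by
  simp [crackedDomain]

theorem crackedDomain_mem_nhds {R₁ : ℝ} (hR₁ : 0 < R₁) (R₂ : ℝ) (N : ℕ) (ε : ℝ) :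
    crackedDomain R₁ R₂ N ε ∈ nhds 0 := by
  refine Filter.mem_of_superset ((isOpen_disk R₁).mem_nhds ?_)
    (subset_union_left.trans subset_union_left)
  change (0 : ℝ) ^ 2 + 0 ^ 2 < R₁ ^ 2
  nlinarith

/-- Points of a circle have polar coordinates based at any reference angle. -/
theorem exists_polar {R : ℝ} (hR : 0 < R) (θ₀ : ℝ) {x : ℝ × ℝ}
    (hx : x.1 ^ 2 + x.2 ^ 2 = R ^ 2) :
    ∃ ψ, |ψ| ≤ π ∧ x = (R * cos (θ₀ + ψ), R * sin (θ₀ + ψ)) := by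
  set z : ℂ := ⟨x.1 * cos θ₀ + x.2 * sin θ₀, x.2 * cos θ₀ - x.1 * sin θ₀⟩ with hz
  have hsc := cos_sq_add_sin_sq θ₀
  have hn : ‖z‖ = R := by
    rw [Complex.norm_eq_sqrt_sq_add_sq, hz]
    rw [show (x.1 * cos θ₀ + x.2 * sin θ₀) ^ 2 + (x.2 * cos θ₀ - x.1 * sin θ₀) ^ 2 =
      (x.1 ^ 2 + x.2 ^ 2) * (cos θ₀ ^ 2 + sin θ₀ ^ 2) by ring, hsc, hx, mul_one,
      Real.sqrt_sq hR.le]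
  have h1 : R * cos z.arg = x.1 * cos θ₀ + x.2 * sin θ₀ := by
    rw [← hn, Complex.norm_mul_cos_arg]
  have h2 : R * sin z.arg = x.2 * cos θ₀ - x.1 * sin θ₀ := by
    rw [← hn, Complex.norm_mul_sin_arg]
  refine ⟨z.arg, Complex.abs_arg_le_pi z, Prod.ext ?_ ?_⟩
  · rw [cos_add]
    linear_combination (-x.1) * hsc - cos θ₀ * h1 + sin θ₀ * h2
  · rw [sin_add]
    linear_combination (-x.2) * hsc - sin θ₀ * h1 - cos θ₀ * h2

theorem isOpen_crackedDomain {R₁ R₂ : ℝ} (hR₁ : 0 < R₁) (h : R₁ < R₂) (N : ℕ) {ε : ℝ}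
    (hε : 0 ≤ ε) (hεπ : ε ≤ π) : IsOpen (crackedDomain R₁ R₂ N ε) := by
  have key : crackedDomain R₁ R₂ N ε = diskUnionAnnulus R₁ R₂ ∪
      (disk R₂ ∩ ⋃ j ∈ Finset.range N, {x : ℝ × ℝ | R₁ * cos ε <
        x.1 * cos (2 * π * j / N) + x.2 * sin (2 * π * j / N)}) := by
    refine Subset.antisymm (union_subset_union_right _ (subset_inter ?_ ?_))
      (union_subset subset_union_left ?_)
    · exact subset_union_right.trans (crackedDomain_subset_disk hR₁ h N ε)
    · refine iUnion₂_mono fun j _ => ?_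
      rintro _ ⟨θ, hθ, rfl⟩
      have h1 : cos ε < cos (θ - 2 * π * j / N) := by
        rw [← cos_abs (θ - _)]
        exact cos_lt_cos_of_nonneg_of_le_pi (abs_nonneg _) hεπ
          (abs_lt.2 ⟨by linarith [hθ.1], by linarith [hθ.2]⟩)
      rw [cos_sub] at h1
      change R₁ * cos ε < R₁ * cos θ * cos (2 * π * j / N) + R₁ * sin θ * sin (2 * π * j / N)
      nlinarith
    · rintro x ⟨hx, hxU⟩
      by_cases hc : x.1 ^ 2 + x.2 ^ 2 = R₁ ^ 2
      · refine Or.inr ?_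
        simp only [mem_iUnion] at hxU ⊢
        obtain ⟨j, hj, hxj⟩ := hxU
        obtain ⟨ψ, hψ, rfl⟩ := exists_polar hR₁ (2 * π * j / N) hc
        refine ⟨j, hj, _, ?_, rfl⟩
        have h1 : R₁ * cos ε < R₁ * cos ψ := by
          refine lt_of_lt_of_eq hxj ?_
          rw [cos_add, sin_add]
          linear_combination R₁ * cos ψ * cos_sq_add_sin_sq (2 * π * j / N)
        have h2 : |ψ| < ε := by
          by_contra! hcon
          have := cos_le_cos_of_nonneg_of_le_pi hε hψ hcon
          rw [cos_abs] at this
          nlinarith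
        rw [abs_lt] at h2
        exact ⟨by linarith, by linarith⟩
      · exact Or.inl (mem_diskUnionAnnulus hx hc)
  rw [key]
  refine (isOpen_diskUnionAnnulus R₁ R₂).union ((isOpen_disk R₂).inter ?_)
  exact isOpen_biUnion fun j _ => isOpen_lt continuous_const (by fun_prop)

/-- The end points of the arcs opened in the cracked domain. -/
def crackTips (R₁ : ℝ) (N : ℕ) (ε : ℝ) : Finset (ℝ × ℝ) :=
  open Classical in
  (Finset.range N).image (fun j : ℕ =>
      (R₁ * cos (2 * π * j / N + ε), R₁ * sin (2 * π * j / N + ε))) ∪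
    (Finset.range N).image fun j : ℕ =>
      (R₁ * cos (2 * π * j / N - ε), R₁ * sin (2 * π * j / N - ε))

theorem mem_crackTips_add {R₁ : ℝ} {N j : ℕ} {ε : ℝ} (hj : j ∈ Finset.range N) :
    (R₁ * cos (2 * π * j / N + ε), R₁ * sin (2 * π * j / N + ε)) ∈ crackTips R₁ N ε :=
  Finset.mem_union_left _ (Finset.mem_image_of_mem _ hj)

theorem mem_crackTips_sub {R₁ : ℝ} {N j : ℕ} {ε : ℝ} (hj : j ∈ Finset.range N) :
    (R₁ * cos (2 * π * j / N - ε), R₁ * sin (2 * π * j / N - ε)) ∈ crackTips R₁ N ε :=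
  Finset.mem_union_right _ (Finset.mem_image_of_mem _ hj)

theorem dist_polar_le {R : ℝ} (hR : 0 < R) (θ φ : ℝ) :
    dist ((R * cos θ, R * sin θ) : ℝ × ℝ) (R * cos φ, R * sin φ) ≤ R * |θ - φ| := by
  rw [Prod.dist_eq, max_le_iff, Real.dist_eq, Real.dist_eq, ← mul_sub, ← mul_sub, abs_mul, abs_mul,
    abs_of_pos hR]
  exact ⟨mul_le_mul_of_nonneg_left (abs_cos_sub_cos_le θ φ) hR.le,
    mul_le_mul_of_nonneg_left (abs_sin_sub_sin_le θ φ) hR.le⟩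

theorem crackedDomain_diff_subset {R₁ : ℝ} (hR₁ : 0 < R₁) (R₂ : ℝ) (N : ℕ) {ε ε' ρ : ℝ}
    (hρ : R₁ * (ε' - ε) ≤ ρ) :
    crackedDomain R₁ R₂ N ε' \ crackedDomain R₁ R₂ N ε ⊆
      ⋃ p ∈ crackTips R₁ N ε, Metric.closedBall p ρ := by
  rintro x ⟨hx | hx, hxε⟩
  · exact absurd (Or.inl hx) hxε
  simp only [mem_iUnion] at hx
  obtain ⟨j, hj, θ, hθ, rfl⟩ := hx
  by_cases h1 : 2 * π * j / N - ε < θ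
  · have h2 : 2 * π * j / N + ε ≤ θ := by
      by_contra! h2
      refine hxε (Or.inr ?_)
      simp only [mem_iUnion]
      exact ⟨j, hj, θ, ⟨h1, h2⟩, rfl⟩
    refine mem_biUnion (mem_crackTips_add hj) ((dist_polar_le hR₁ _ _).trans (le_trans ?_ hρ))
    gcongr
    exact abs_le.2 ⟨by linarith [hθ.2], by linarith [hθ.2]⟩
  · refine mem_biUnion (mem_crackTips_sub hj) ((dist_polar_le hR₁ _ _).trans (le_trans ?_ hρ))
    gcongr
    exact abs_le.2 ⟨by linarith [hθ.1], by linarith [hθ.1]⟩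

theorem disk_diff_crackedDomain_subset {R₁ R₂ : ℝ} (hR₁ : 0 < R₁) {N : ℕ} (hN : 1 ≤ N) :
    disk R₂ \ crackedDomain R₁ R₂ N (π / N) ⊆ crackTips R₁ N (π / N) := by
  rintro x ⟨hx, hxN⟩
  have hc : x.1 ^ 2 + x.2 ^ 2 = R₁ ^ 2 := by
    by_contra hc
    exact hxN (Or.inl (mem_diskUnionAnnulus hx hc))
  obtain ⟨θ, -, rfl⟩ := exists_polar hR₁ 0 hc
  rw [zero_add] at *
  have hN0 : (0 : ℝ) < N := by exact_mod_cast hN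
  set n : ℤ := round (θ * N / (2 * π)) with hn
  have hround := abs_sub_round (θ * N / (2 * π))
  rw [← hn] at hround
  obtain ⟨j, hj⟩ : ∃ j : ℕ, (j : ℤ) = n % N :=
    ⟨(n % N).toNat, Int.toNat_of_nonneg (Int.emod_nonneg _ (by omega))⟩
  have hjN : j ∈ Finset.range N := by
    have := Int.emod_lt_of_pos n (show (0 : ℤ) < N by omega)
    rw [Finset.mem_range]
    omega
  have hdiv : (n : ℝ) = j + N * (n / N : ℤ) := by
    have h1 := Int.emod_add_mul_ediv n N
    rw [← hj] at h1
    exact_mod_cast h1.symm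
  set φ : ℝ := θ - (n / N : ℤ) * (2 * π) with hφ
  have hcos : cos θ = cos φ := (cos_sub_int_mul_two_pi θ _).symm
  have hsin : sin θ = sin φ := (sin_sub_int_mul_two_pi θ _).symm
  have hdist : |φ - 2 * π * j / N| ≤ π / N := by
    have e : φ - 2 * π * j / N = (θ * N / (2 * π) - n) * (2 * π / N) := by
      rw [hdiv, hφ]
      field_simp
      ring
    rw [e, abs_mul, abs_of_pos (show 0 < 2 * π / N by positivity)]
    calc _ ≤ 1 / 2 * (2 * π / N) := by gcongr
      _ = π / N := by ring
  rw [hcos, hsin] at hxN ⊢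
  rcases hdist.lt_or_eq with hlt | heq
  · refine absurd (Or.inr ?_) hxN
    simp only [mem_iUnion]
    rw [abs_lt] at hlt
    exact ⟨j, hjN, φ, ⟨by linarith, by linarith⟩, rfl⟩
  · rcases eq_or_eq_neg_of_abs_eq heq with he | he
    · rw [show φ = 2 * π * j / N + π / N by linarith]
      exact mem_crackTips_add hjN
    · rw [show φ = 2 * π * j / N - π / N by linarith]
      exact mem_crackTips_sub hjN

theorem crackedDomain_subset_iUnion {R₁ R₂ : ℝ} {N : ℕ} {ε : ℝ} (hε : 0 < ε) :
    crackedDomain R₁ R₂ N ε ⊆ ⋃ t : Ico 0 ε, crackedDomain R₁ R₂ N t := by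
  rintro x (hx | hx)
  · exact mem_iUnion.2 ⟨⟨0, le_rfl, hε⟩, Or.inl hx⟩
  · simp only [mem_iUnion] at hx
    obtain ⟨j, hj, θ, hθ, rfl⟩ := hx
    obtain ⟨t, ht1, ht2⟩ := exists_between (abs_lt.2
      (⟨by linarith [hθ.1], by linarith [hθ.2]⟩ : -ε < θ - 2 * π * j / N ∧ _ < ε))
    refine mem_iUnion.2 ⟨⟨t, (abs_nonneg _).trans ht1.le, ht2⟩, Or.inr ?_⟩
    simp only [mem_iUnion]
    rw [abs_lt] at ht1
    exact ⟨j, hj, θ, ⟨by linarith, by linarith⟩, rfl⟩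

theorem dirichletEV_crackedDomain_antitone {R₁ : ℝ} (hR₁ : 0 < R₁) (R₂ : ℝ) (N : ℕ) {k : ℕ}
    (hk : 1 ≤ k) : Antitone fun ε => dirichletEV (crackedDomain R₁ R₂ N ε) k := by
  intro ε ε' h
  obtain ⟨l₀, h₀⟩ := exists_hasTrialSpace (crackedDomain_mem_nhds hR₁ R₂ N ε) k
  refine le_of_forall_gt fun l hl => ?_
  obtain ⟨m, hm, hml⟩ := exists_between hl
  exact (((hasTrialSpace_of_dirichletEV_lt hk h₀ hm).mono
    (crackedDomain_mono R₁ R₂ N h)).dirichletEV_le hk).trans_lt hml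

theorem dirichletEV_crackedDomain_pi_div {R₁ R₂ : ℝ} (hR₁ : 0 < R₁) (h : R₁ < R₂) {N k : ℕ}
    (hN : 1 ≤ N) (hk : 1 ≤ k) :
    dirichletEV (crackedDomain R₁ R₂ N (π / N)) k = dirichletEV (disk R₂) k := by
  have hsub := crackedDomain_subset_disk hR₁ h N (π / N)
  obtain ⟨l₀, h₀⟩ := exists_hasTrialSpace (crackedDomain_mem_nhds hR₁ R₂ N (π / N)) k
  refine le_antisymm (le_of_forall_pos_le_add fun δ hδ => ?_) (le_of_forall_gt fun l hl => ?_)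
  · obtain ⟨ρ, hρ, H⟩ := exists_hasTrialSpace_diff_iUnion_closedBall
      (crackTips R₁ N (π / N)) R₂ (l := dirichletEV (disk R₂) k + δ / 2) (δ := δ / 2)
      (add_nonneg (dirichletEV_nonneg _ _) (by linarith)) (by linarith)
    have h1 := H _ Subset.rfl k
      (hasTrialSpace_of_dirichletEV_lt hk (h₀.mono hsub) (by linarith))
    rw [add_assoc, add_halves] at h1
    refine (h1.mono fun x hx => ?_).dirichletEV_le hk
    by_contra hxN
    exact hx.2 (mem_biUnion (disk_diff_crackedDomain_subset hR₁ hN ⟨hx.1, hxN⟩)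
      (Metric.mem_closedBall_self hρ.le))
  · obtain ⟨m, hm, hml⟩ := exists_between hl
    exact (((hasTrialSpace_of_dirichletEV_lt hk h₀ hm).mono hsub).dirichletEV_le hk).trans_lt hml

theorem eventually_lt_dirichletEV_crackedDomain {R₁ R₂ : ℝ} (hR₁ : 0 < R₁) (h : R₁ < R₂) (N : ℕ)
    {k : ℕ} (hk : 1 ≤ k) {ε l : ℝ} (hl : l < dirichletEV (crackedDomain R₁ R₂ N ε) k) :
    ∀ᶠ t in nhds ε, l < dirichletEV (crackedDomain R₁ R₂ N t) k := by
  rcases lt_or_ge l 0 with hl0 | hl0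
  · exact Filter.Eventually.of_forall fun t => hl0.trans_le (dirichletEV_nonneg _ _)
  obtain ⟨m, hlm, hm⟩ := exists_between hl
  obtain ⟨m', hmm', hm'⟩ := exists_between hm
  obtain ⟨ρ, hρ, H⟩ := exists_hasTrialSpace_diff_iUnion_closedBall (crackTips R₁ N ε) R₂
    (l := m) (δ := m' - m) (hl0.trans hlm.le) (by linarith)
  have hev : ∀ᶠ t in nhds ε, R₁ * (t - ε) < ρ :=
    (continuous_const.mul (continuous_id.sub continuous_const)).continuousAt.eventually_lt
      continuousAt_const (by simpa using hρ)
  filter_upwards [hev] with t ht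
  by_contra! hcon
  obtain ⟨l₀, h₀⟩ := exists_hasTrialSpace (crackedDomain_mem_nhds hR₁ R₂ N t) k
  have h1 := H _ (crackedDomain_subset_disk hR₁ h N t) k
    (hasTrialSpace_of_dirichletEV_lt hk h₀ (hcon.trans_lt hlm))
  rw [add_sub_cancel] at h1
  refine absurd ((h1.mono fun x hx => ?_).dirichletEV_le hk) (not_le.2 hm')
  by_contra hxε
  exact hx.2 (crackedDomain_diff_subset hR₁ R₂ N ht.le ⟨hx.1, hxε⟩)

theorem eventually_dirichletEV_crackedDomain_lt {R₁ R₂ : ℝ} (hR₁ : 0 < R₁) (h : R₁ < R₂) (N : ℕ)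
    {k : ℕ} (hk : 1 ≤ k) {ε l : ℝ} (hε : 0 ≤ ε) (hεπ : ε ≤ π)
    (hl : dirichletEV (crackedDomain R₁ R₂ N ε) k < l) :
    ∀ᶠ t in nhdsWithin ε (Ici 0), dirichletEV (crackedDomain R₁ R₂ N t) k < l := by
  have hanti := dirichletEV_crackedDomain_antitone hR₁ R₂ N hk
  rcases hε.eq_or_lt with rfl | hε0
  · filter_upwards [self_mem_nhdsWithin] with t ht using (hanti ht).trans_lt hl
  obtain ⟨m, hm, hml⟩ := exists_between hl
  obtain ⟨l₀, h₀⟩ := exists_hasTrialSpace (crackedDomain_mem_nhds hR₁ R₂ N ε) k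
  have : Nonempty (Ico 0 ε) := ⟨⟨0, le_rfl, hε0⟩⟩
  obtain ⟨s, hs⟩ := (hasTrialSpace_of_dirichletEV_lt hk h₀ hm).exists_of_subset_iUnion
    (U := fun t : Ico 0 ε => crackedDomain R₁ R₂ N t)
    (fun t => isOpen_crackedDomain hR₁ h N t.2.1 (t.2.2.le.trans hεπ))
    (Monotone.directed_le fun a b hab => crackedDomain_mono R₁ R₂ N hab) hk
    (crackedDomain_subset_iUnion hε0)
  refine nhdsWithin_le_nhds ?_
  filter_upwards [Ioi_mem_nhds s.2.2] with t ht
  exact ((hanti (le_of_lt ht)).trans (hs.dirichletEV_le hk)).trans_lt hml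

/-- for each `k ≥ 1`, `ε ↦ λ_k(𝔇(N,ε))` is nonincreasing and continuous on
`[0, π/N]`, with `λ_k(𝔇(N,0)) = λ_k(D_{R₁,R₂})` and `λ_k(𝔇(N,π/N)) = λ_k(B_{R₂})`. -/
theorem eigenvalue_monotone_continuous_in_crack
    (R₁ R₂ : ℝ) (hR₁ : 0 < R₁) (hR₁₂ : R₁ < R₂) (N : ℕ) (hN : 1 ≤ N) (k : ℕ) (hk : 1 ≤ k) :
    AntitoneOn (fun ε => dirichletEV (crackedDomain R₁ R₂ N ε) k) (Set.Icc 0 (π / N)) ∧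
    ContinuousOn (fun ε => dirichletEV (crackedDomain R₁ R₂ N ε) k) (Set.Icc 0 (π / N)) ∧
    dirichletEV (crackedDomain R₁ R₂ N 0) k = dirichletEV (diskUnionAnnulus R₁ R₂) k ∧
    dirichletEV (crackedDomain R₁ R₂ N (π / N)) k = dirichletEV (disk R₂) k := by
  have hanti := dirichletEV_crackedDomain_antitone hR₁ R₂ N hk
  have hN' : π / N ≤ π := div_le_self pi_pos.le (by exact_mod_cast hN)
  refine ⟨hanti.antitoneOn _, fun ε hε => ?_, by rw [crackedDomain_zero],
    dirichletEV_crackedDomain_pi_div hR₁ hR₁₂ hN hk⟩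
  refine tendsto_order.2 ⟨fun l hl => ?_, fun l hl => ?_⟩
  · exact nhdsWithin_le_nhds (eventually_lt_dirichletEV_crackedDomain hR₁ hR₁₂ N hk hl)
  · exact nhdsWithin_mono ε Icc_subset_Ici_self
      (eventually_dirichletEV_crackedDomain_lt hR₁ hR₁₂ N hk hε.1 (hε.2.trans hN') hl)
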